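/- arXiv:2009.08806 — 2 statements merged into one kernel-verified Lean document; each statement's English description precedes it below -/
import Mathlib

section
/- Under the (P4+kP3)-free setup, suppose that no minimum total dominating set of G contains a P3, and let D be a minimum total dominating set of G. Say that a B-edge xy of D can be turned into a B−C-edge if there exists a vertex z ∈ C such that (D∖{x})∪{z} or (D∖{y})∪{z} is a total dominating set of G. If D contains a B-edge such that some vertex of C is a private neighbor (with respect to D) of one of its endpoints and this B-edge cannot be turned into a B−C-edge, then D contains at most |A|+2k B-edges. -/
open SimpleGraph

namespace TD

variable {V : Type*} {α β : Type*}

/-- `D` is a total dominating set of `G`: every vertex has a neighbor in `D`. -/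
def IsTotalDomSet (G : SimpleGraph V) (D : Set V) : Prop :=
  ∀ v : V, ∃ u ∈ D, G.Adj v u

/-- The total domination number `γ_t(G)`. -/
noncomputable def totalDomNum (G : SimpleGraph V) : ℕ :=
  sInf {m : ℕ | ∃ D : Set V, IsTotalDomSet G D ∧ D.ncard = m}

/-- A minimum total dominating set. -/
def IsMinTotalDomSet (G : SimpleGraph V) (D : Set V) : Prop :=
  IsTotalDomSet G D ∧ D.ncard = totalDomNum G

/-- `S` contains a `P3`: three distinct vertices `a, b, c ∈ S` with `ab, bc ∈ E(G)`. -/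
def HasP3 (G : SimpleGraph V) (S : Set V) : Prop :=
  ∃ a b c : V, a ∈ S ∧ b ∈ S ∧ c ∈ S ∧ a ≠ b ∧ b ≠ c ∧ a ≠ c ∧ G.Adj a b ∧ G.Adj b c

/-- `D` is a dominating set of `G`. -/
def IsDomSet (G : SimpleGraph V) (D : Set V) : Prop :=
  ∀ v ∉ D, ∃ u ∈ D, G.Adj v u

/-- The domination number `γ(G)`. -/
noncomputable def domNum (G : SimpleGraph V) : ℕ :=
  sInf {m : ℕ | ∃ D : Set V, IsDomSet G D ∧ D.ncard = m}

/-- The (open) neighborhood of a set `S`: union of the neighborhoods of its members. -/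
def nbhd (G : SimpleGraph V) (S : Set V) : Set V :=
  {v | ∃ u ∈ S, G.Adj u v}

/-- The closed neighborhood `N[S]`. -/
def closedNbhd (G : SimpleGraph V) (S : Set V) : Set V :=
  S ∪ nbhd G S

/-- Distance between two sets of vertices. -/
noncomputable def setDist (G : SimpleGraph V) (S T : Set V) : ℕ :=
  sInf {m : ℕ | ∃ u ∈ S, ∃ v ∈ T, G.dist u v = m}

/-- `k` disjoint copies of `H`. -/
def kCopies (k : ℕ) (H : SimpleGraph α) : SimpleGraph (Fin k × α) where
  Adj p q := p.1 = q.1 ∧ H.Adj p.2 q.2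
  symm := ⟨fun _ _ h => ⟨h.1.symm, h.2.symm⟩⟩
  loopless := ⟨fun p h => H.loopless.irrefl p.2 h.2⟩

/-- The graph `P4 + k·P3`. -/
def p4kp3 (k : ℕ) : SimpleGraph (Fin 4 ⊕ (Fin k × Fin 3)) :=
  (pathGraph 4) ⊕g (kCopies k (pathGraph 3))

/-- `G` contains no induced copy of `H` (`G` is `H`-free). -/
def IndFree (G : SimpleGraph V) (H : SimpleGraph α) : Prop :=
  ¬ Nonempty (H ↪g G)

/-- `K` is a maximal clique of the subgraph of `G` induced by `C`. -/
def IsMaxCliqueWithin (G : SimpleGraph V) (C K : Set V) : Prop :=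
  K ⊆ C ∧ G.IsClique K ∧ ∀ K' : Set V, K' ⊆ C → G.IsClique K' → K ⊆ K' → K' = K

/-- Member of `𝒦'`: a maximal clique of `G[C]` whose closed neighborhood contains no
induced `P4` and such that no vertex of `B` is adjacent to all of its vertices. -/
def GoodClique (G : SimpleGraph V) (B C K : Set V) : Prop :=
  IsMaxCliqueWithin G C K ∧
    IndFree (G.induce (closedNbhd G K)) (pathGraph 4) ∧
    ¬ ∃ b ∈ B, ∀ x ∈ K, G.Adj b x

/-- A regular clique: a member of `𝒦'` for which there are `k` other members of `𝒦'`
pairwise at distance at least four from one another and from it. -/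
def RegularClique (G : SimpleGraph V) (k : ℕ) (B C K : Set V) : Prop :=
  GoodClique G B C K ∧
    ∃ Ks : Fin k → Set V,
      (∀ i, GoodClique G B C (Ks i)) ∧
      (∀ i, 4 ≤ setDist G K (Ks i)) ∧
      ∀ i j : Fin k, i ≠ j → 4 ≤ setDist G (Ks i) (Ks j)

/-- `w` is a private neighbor of `v` with respect to `D`: `N(w) ∩ D = {v}`. -/
def IsPrivateNbr (G : SimpleGraph V) (D : Set V) (v w : V) : Prop :=
  {u | u ∈ D ∧ G.Adj w u} = {v}

end TD

open TD SimpleGraph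

namespace TD

variable {V : Type*} {G : SimpleGraph V} {D S T : Set V}

lemma IsTotalDomSet.mono (hS : IsTotalDomSet G S) (hST : S ⊆ T) : IsTotalDomSet G T := fun v ↦
  let ⟨u, hu, hvu⟩ := hS v
  ⟨u, hST hu, hvu⟩

lemma IsMinTotalDomSet.ncard_le (hD : IsMinTotalDomSet G D) (hS : IsTotalDomSet G S) :
    D.ncard ≤ S.ncard :=
  hD.2 ▸ Nat.sInf_le ⟨S, hS, rfl⟩

/-- If no minimum total dominating set contains a `P3`, a total dominating set that contains one
is not minimum. -/
lemma IsMinTotalDomSet.ncard_lt_of_hasP3 (hD : IsMinTotalDomSet G D)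
    (hnoP3 : ∀ D' : Set V, IsMinTotalDomSet G D' → ¬ HasP3 G D')
    (hS : IsTotalDomSet G S) (hP3 : HasP3 G S) : D.ncard < S.ncard :=
  (hD.ncard_le hS).lt_of_ne fun h ↦ hnoP3 S ⟨hS, h ▸ hD.2⟩ hP3

lemma eq_of_adj_of_not_hasP3 (hS : ¬ HasP3 G S) {a b c : V} (ha : a ∈ S) (hb : b ∈ S)
    (hc : c ∈ S) (hab : G.Adj a b) (hbc : G.Adj b c) : a = c := by
  by_contra hac
  exact hS ⟨a, b, c, ha, hb, hc, hab.ne, hbc.ne, hac, hab, hbc⟩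

@[simp]
lemma p4kp3_adj_inl_inl {k : ℕ} {i j : Fin 4} :
    (p4kp3 k).Adj (.inl i) (.inl j) ↔ (pathGraph 4).Adj i j :=
  Iff.rfl

@[simp]
lemma p4kp3_adj_inr_inr {k : ℕ} {q r : Fin k × Fin 3} :
    (p4kp3 k).Adj (.inr q) (.inr r) ↔ q.1 = r.1 ∧ (pathGraph 3).Adj q.2 r.2 :=
  Iff.rfl

@[simp]
lemma not_p4kp3_adj_inl_inr {k : ℕ} {i : Fin 4} {q : Fin k × Fin 3} :
    ¬ (p4kp3 k).Adj (.inl i) (.inr q) :=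
  not_adj_sum_inl_inr i q

@[simp]
lemma not_p4kp3_adj_inr_inl {k : ℕ} {i : Fin 4} {q : Fin k × Fin 3} :
    ¬ (p4kp3 k).Adj (.inr q) (.inl i) :=
  fun h ↦ not_p4kp3_adj_inl_inr h.symm

lemma exists_adj_p4kp3 {k : ℕ} (u : Fin 4 ⊕ (Fin k × Fin 3)) : ∃ v, (p4kp3 k).Adj u v := by
  rcases u with i | ⟨i, t⟩
  · have : ∃ j, (pathGraph 4).Adj i j := by
      simp only [pathGraph_adj]
      revert i
      decide
    obtain ⟨j, hj⟩ := this
    exact ⟨.inl j, by simpa using hj⟩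
  · have : ∃ j, (pathGraph 3).Adj t j := by
      simp only [pathGraph_adj]
      revert t
      decide
    obtain ⟨j, hj⟩ := this
    exact ⟨.inr (i, j), by simpa using hj⟩

lemma ncard_range_p4kp3 {k : ℕ} (φ : p4kp3 k ↪g G) : (Set.range φ).ncard = 4 + 3 * k := by
  rw [← Set.image_univ, Set.ncard_image_of_injective _ φ.injective, Set.ncard_univ,
    Nat.card_eq_fintype_card]
  simp [mul_comm]

/-- An induced `P4` is an induced copy of `P4 + 0·P3`. -/
lemma exists_p4kp3_zero_embedding {w x y v : V} (hwx : G.Adj w x) (hxy : G.Adj x y)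
    (hyv : G.Adj y v) (hwy : ¬ G.Adj w y) (hxv : ¬ G.Adj x v) (hwv : ¬ G.Adj w v) :
    ∃ φ : p4kp3 0 ↪g G, Set.range φ = {w, x, y, v} := by
  have hwy' : w ≠ y := by rintro rfl; exact hwv hyv
  have hxv' : x ≠ v := by rintro rfl; exact hwv hwx
  have hwv' : w ≠ v := by rintro rfl; exact hwy hyv.symm
  have e1 := hwx.ne
  have e2 := hxy.ne
  have e3 := hyv.ne
  let f : Fin 4 ⊕ (Fin 0 × Fin 3) → V := Sum.elim ![w, x, y, v] fun q ↦ q.1.elim0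
  have hinj : Function.Injective f := by
    rintro (i | ⟨i, -⟩) (j | ⟨j, -⟩)
    · fin_cases i <;> fin_cases j <;> simp_all [f, eq_comm]
    all_goals first | exact i.elim0 | exact j.elim0
  have hadj : ∀ s t, G.Adj (f s) (f t) ↔ (p4kp3 0).Adj s t := by
    rintro (i | ⟨i, -⟩) (j | ⟨j, -⟩)
    · fin_cases i <;> fin_cases j <;> simp_all [f, pathGraph_adj, G.adj_comm]
    all_goals first | exact i.elim0 | exact j.elim0
  have hrange : Set.range f = {w, x, y, v} := by
    ext u
    simp [f]
    tauto
  exact ⟨⟨⟨f, hinj⟩, hadj _ _⟩, hrange⟩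

/-- An induced `P3` disjoint from and anticomplete to an induced `P4 + k·P3` extends it to an
induced `P4 + (k+1)·P3`. -/
lemma exists_p4kp3_succ_embedding {k : ℕ} (φ : p4kp3 k ↪g G) {p a b : V} (hpa : G.Adj p a)
    (hab : G.Adj a b) (hpb : ¬ G.Adj p b) (hne : p ≠ b)
    (hanti : ∀ t ∈ ({p, a, b} : Set V), t ∉ Set.range φ ∧ ∀ r ∈ Set.range φ, ¬ G.Adj t r) :
    ∃ ψ : p4kp3 (k + 1) ↪g G, Set.range ψ = Set.range φ ∪ {p, a, b} := by
  let g : Fin 3 → V := ![p, a, b]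
  have hg : ∀ t, g t ∈ ({p, a, b} : Set V) := by
    intro t; fin_cases t <;> simp [g]
  have hginj : Function.Injective g := by
    have e1 := hpa.ne
    have e2 := hab.ne
    intro s t
    fin_cases s <;> fin_cases t <;> simp_all [g, eq_comm]
  have hgadj : ∀ s t, G.Adj (g s) (g t) ↔ (pathGraph 3).Adj s t := by
    intro s t
    fin_cases s <;> fin_cases t <;> simp_all [g, pathGraph_adj, G.adj_comm]
  have hne' : ∀ t u, φ u ≠ g t := fun t u h ↦ (hanti _ (hg t)).1 ⟨u, h⟩
  have hnadj : ∀ t u, ¬ G.Adj (g t) (φ u) := fun t u ↦ (hanti _ (hg t)).2 _ ⟨u, rfl⟩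
  have hnadj' : ∀ t u, ¬ G.Adj (φ u) (g t) := fun t u h ↦ hnadj t u h.symm
  let f : Fin 4 ⊕ (Fin (k + 1) × Fin 3) → V :=
    Sum.elim (fun i ↦ φ (.inl i))
      fun q ↦ Fin.lastCases (motive := fun _ ↦ V) (g q.2) (fun i ↦ φ (.inr (i, q.2))) q.1
  have f1 : ∀ i, f (.inl i) = φ (.inl i) := fun _ ↦ rfl
  have f2 : ∀ t, f (.inr (Fin.last k, t)) = g t := fun t ↦ by simp [f]
  have f3 : ∀ i t, f (.inr (Fin.castSucc i, t)) = φ (.inr (i, t)) := fun i t ↦ by simp [f]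
  have hcs : ∀ i : Fin k, i.castSucc ≠ Fin.last k := fun i ↦ (Fin.castSucc_lt_last i).ne
  have hinj : Function.Injective f := by
    rintro (i | ⟨i, s⟩) (j | ⟨j, t⟩)
    · simp [f1]
    · induction j using Fin.lastCases <;> simp [f1, f2, f3, hne']
    · induction i using Fin.lastCases <;> simp [f1, f2, f3, (hne' _ _).symm]
    · induction i using Fin.lastCases <;> induction j using Fin.lastCases <;>
        simp [f2, f3, hne', (hne' _ _).symm, hginj.eq_iff]
  have hadj : ∀ s t, G.Adj (f s) (f t) ↔ (p4kp3 (k + 1)).Adj s t := by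
    rintro (i | ⟨i, s⟩) (j | ⟨j, t⟩)
    · simp [f1]
    · induction j using Fin.lastCases <;> simp [f1, f2, f3, hnadj']
    · induction i using Fin.lastCases <;> simp [f1, f2, f3, hnadj]
    · induction i using Fin.lastCases <;> induction j using Fin.lastCases <;>
        simp [f2, f3, hnadj, hnadj', hgadj, hcs, (hcs _).symm]
  have hrange : ({p, a, b} : Set V) = Set.range g := by
    ext u
    simp [g]
    tauto
  refine ⟨⟨⟨f, hinj⟩, hadj _ _⟩, ?_⟩
  rw [hrange]
  ext u
  constructor
  · rintro ⟨i | ⟨i, s⟩, rfl⟩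
    · exact .inl ⟨_, rfl⟩
    · induction i using Fin.lastCases with
      | last => exact .inr ⟨s, (f2 s).symm⟩
      | cast i => exact .inl ⟨_, (f3 i s).symm⟩
  · rintro (⟨i | ⟨i, s⟩, rfl⟩ | ⟨s, rfl⟩)
    · exact ⟨.inl i, rfl⟩
    · exact ⟨.inr (i.castSucc, s), f3 i s⟩
    · exact ⟨.inr (Fin.last k, s), f2 s⟩

/-- A `P3`-free set `M` spans at most `|M| / 2` edges. -/
lemma two_mul_ncard_edges_le [Fintype V] {M : Set V} (hM : ¬ HasP3 G M) :
    2 * {e : Sym2 V | ∃ x y, e = s(x, y) ∧ G.Adj x y ∧ x ∈ M ∧ y ∈ M}.ncard ≤ M.ncard := by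
  classical
  let H : SimpleGraph V :=
    { Adj := fun x y ↦ G.Adj x y ∧ x ∈ M ∧ y ∈ M
      symm := ⟨fun _ _ h ↦ ⟨h.1.symm, h.2.2, h.2.1⟩⟩
      loopless := ⟨fun _ h ↦ h.1.ne rfl⟩ }
  have hE : {e : Sym2 V | ∃ x y, e = s(x, y) ∧ G.Adj x y ∧ x ∈ M ∧ y ∈ M} = H.edgeFinset := by
    ext e
    induction e with | _ x y
    simp only [Set.mem_ofPred_eq, coe_edgeFinset, mem_edgeSet]
    constructor
    · rintro ⟨x', y', he, h⟩
      rw [← mem_edgeSet, he]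
      exact h
    · exact fun h ↦ ⟨x, y, rfl, h⟩
  rw [hE, Set.ncard_coe_finset, ← sum_degrees_eq_twice_card_edges, Set.ncard_eq_toFinset_card',
    Finset.card_eq_sum_ones, ← Finset.sum_subset (Finset.subset_univ M.toFinset)]
  · refine Finset.sum_le_sum fun x _ ↦ Finset.card_le_one.2 fun a ha b hb ↦ ?_
    rw [mem_neighborFinset] at ha hb
    exact eq_of_adj_of_not_hasP3 hM ha.2.2 ha.2.1 hb.2.2 ha.1.symm hb.1
  · intro x _ hx
    rw [← card_neighborFinset_eq_degree, Finset.card_eq_zero, Finset.eq_empty_iff_forall_notMem]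
    intro a ha
    rw [mem_neighborFinset] at ha
    exact hx (Set.mem_toFinset.2 ha.2.1)

/-- An edge-free subset of a `P3`-free set without isolated vertices has at most half of its
elements. -/
lemma two_mul_ncard_le_of_independent [Finite V] (hT : ¬ HasP3 G T)
    (hclosed : ∀ s ∈ T, ∃ t ∈ T, G.Adj s t) (hST : S ⊆ T)
    (hS : ∀ a ∈ S, ∀ b ∈ S, ¬ G.Adj a b) : 2 * S.ncard ≤ T.ncard := by
  have : ∀ s, ∃ t, s ∈ T → t ∈ T ∧ G.Adj s t := fun s ↦ by
    by_cases hs : s ∈ T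
    · obtain ⟨t, ht⟩ := hclosed s hs
      exact ⟨t, fun _ ↦ ht⟩
    · exact ⟨s, fun h ↦ absurd h hs⟩
  choose m hm using this
  have h1 : S.ncard ≤ (T \ S).ncard := by
    refine Set.ncard_le_ncard_of_injOn m (fun s hs ↦ ⟨(hm s (hST hs)).1, fun h ↦ ?_⟩)
      fun s hs t ht hst ↦ ?_
    · exact hS _ hs _ h (hm s (hST hs)).2
    · exact eq_of_adj_of_not_hasP3 hT (hST hs) (hm s (hST hs)).1 (hST ht) (hm s (hST hs)).2
        (hst ▸ (hm t (hST ht)).2.symm)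
  have h2 := Set.ncard_sdiff_add_ncard_of_subset hST
  omega

/-- Some induced `P4 + j·P3` totally dominates `G` together with `A`, `D \ M` and a set `S`
disjoint from and anticomplete to it, where `S` lies in a subset `T` of `M` that has no isolated
vertices and misses at least `2j + 2` elements of `M`. -/
def HasPartialPacking (G : SimpleGraph V) (A D M : Set V) (j : ℕ) : Prop :=
  ∃ (φ : p4kp3 j ↪g G) (S T : Set V), S ⊆ T ∧ T ⊆ M ∧ (∀ s ∈ T, ∃ t ∈ T, G.Adj s t) ∧
    T.ncard + 2 * j + 2 ≤ M.ncard ∧ IsTotalDomSet G (A ∪ D \ M ∪ Set.range φ ∪ S) ∧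
    ∀ s ∈ S, s ∉ Set.range φ ∧ ∀ r ∈ Set.range φ, ¬ G.Adj s r

lemma ncard_diff_pair_add_two [Finite V] {a b : V} (ha : a ∈ T) (hb : b ∈ T) (hab : a ≠ b) :
    (T \ {a, b}).ncard + 2 = T.ncard := by
  rw [← Set.ncard_pair hab]
  exact Set.ncard_sdiff_add_ncard_of_subset (Set.pair_subset ha hb)

lemma matched_diff_pair (hT : ¬ HasP3 G T) (hclosed : ∀ s ∈ T, ∃ t ∈ T, G.Adj s t) {a b : V}
    (ha : a ∈ T) (hb : b ∈ T) (hab : G.Adj a b) :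
    ∀ s ∈ T \ {a, b}, ∃ t ∈ T \ {a, b}, G.Adj s t := by
  rintro s ⟨hs, hsab⟩
  obtain ⟨t, ht, hst⟩ := hclosed s hs
  refine ⟨t, ⟨ht, ?_⟩, hst⟩
  rintro (rfl | rfl)
  · exact hsab (.inr (eq_of_adj_of_not_hasP3 hT hs ha hb hst hab))
  · exact hsab (.inl (eq_of_adj_of_not_hasP3 hT hs hb ha hst hab.symm))

lemma HasP3.mono (hS : HasP3 G S) (hST : S ⊆ T) : HasP3 G T :=
  let ⟨a, b, c, ha, hb, hc, h⟩ := hS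
  ⟨a, b, c, hST ha, hST hb, hST hc, h⟩

lemma HasPartialPacking.succ [Finite V] {A M : Set V} {j : ℕ}
    (hP : HasPartialPacking G A D M j)
    (hnoP3 : ∀ D' : Set V, IsMinTotalDomSet G D' → ¬ HasP3 G D') (hD : IsMinTotalDomSet G D)
    (hAP3 : HasP3 G A) (hMD : M ⊆ D) (hMA : ∀ b ∈ M, b ∉ A ∧ ∃ a ∈ A, G.Adj b a)
    (hcard : 2 * A.ncard + 4 * (j + 1) < M.ncard) : HasPartialPacking G A D M (j + 1) := by
  obtain ⟨φ, S₀, T, hS₀T, hTM, hT, hTcard, hS₀, hφS₀⟩ := hP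
  have hDP3 := hnoP3 D hD
  have hTP3 : ¬ HasP3 G T := fun h ↦ hDP3 (h.mono (hTM.trans hMD))
  obtain ⟨S, hSS₀, hSmin⟩ := exists_minimal_le_of_wellFoundedLT
    (fun S ↦ IsTotalDomSet G (A ∪ D \ M ∪ Set.range φ ∪ S)) S₀ hS₀
  have hS : IsTotalDomSet G (A ∪ D \ M ∪ Set.range φ ∪ S) := hSmin.prop
  have hST : S ⊆ T := hSS₀.trans hS₀T
  have hSM : S ⊆ M := hST.trans hTM
  have hφS : ∀ s ∈ S, s ∉ Set.range φ ∧ ∀ r ∈ Set.range φ, ¬ G.Adj s r :=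
    fun s hs ↦ hφS₀ s (hSS₀ hs)
  have hab : ∃ a ∈ S, ∃ b ∈ S, G.Adj a b := by
    by_contra! h
    have h1 := two_mul_ncard_le_of_independent hTP3 hT hST h
    have h2 := hD.ncard_lt_of_hasP3 hnoP3 hS (hAP3.mono fun u hu ↦ .inl (.inl (.inl hu)))
    have h3 := Set.ncard_union_le (A ∪ D \ M ∪ Set.range φ) S
    have h4 := Set.ncard_union_le (A ∪ D \ M) (Set.range φ)
    have h5 := Set.ncard_union_le A (D \ M)
    have h6 := Set.ncard_sdiff_add_ncard_of_subset hMD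
    rw [ncard_range_p4kp3] at h4
    omega
  obtain ⟨a, haS, b, hbS, hab⟩ := hab
  obtain ⟨p, hp⟩ : ∃ p, ∀ u ∈ A ∪ D \ M ∪ Set.range φ ∪ S \ {a}, ¬ G.Adj p u := by
    have : ¬ IsTotalDomSet G (A ∪ D \ M ∪ Set.range φ ∪ S \ {a}) := fun h ↦
      (hSmin.le_of_le h Set.sdiff_subset haS).2 rfl
    simpa [IsTotalDomSet] using this
  have hpA : ∀ u ∈ A, ¬ G.Adj p u := fun u hu ↦ hp u (.inl (.inl (.inl hu)))
  have hpφ : ∀ u ∈ Set.range φ, ¬ G.Adj p u := fun u hu ↦ hp u (.inl (.inr hu))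
  have hpS : ∀ u ∈ S, u ≠ a → ¬ G.Adj p u := fun u hu hua ↦ hp u (.inr ⟨hu, hua⟩)
  have hpa : G.Adj p a := by
    obtain ⟨u, hu, hpu⟩ := hS p
    by_cases hua : u = a
    · exact hua ▸ hpu
    · exact absurd hpu <| hp u <| hu.imp id fun h ↦ ⟨h, hua⟩
  have hpM : p ∉ M := fun h ↦
    let ⟨u, hu, hpu⟩ := (hMA p h).2
    hpA u hu hpu
  have hpR : p ∉ Set.range φ := by
    rintro ⟨u, rfl⟩
    obtain ⟨v, huv⟩ := exists_adj_p4kp3 u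
    exact hpφ _ ⟨v, rfl⟩ (φ.map_adj_iff.2 huv)
  obtain ⟨ψ, hψ⟩ := exists_p4kp3_succ_embedding φ hpa hab (hpS b hbS hab.ne')
    (fun h ↦ hpM (h ▸ hSM hbS)) (by
      rintro t (rfl | rfl | rfl)
      exacts [⟨hpR, hpφ⟩, hφS _ haS, hφS _ hbS])
  refine ⟨ψ, S \ {a, b}, T \ {a, b}, Set.sdiff_subset_sdiff_left hST, Set.sdiff_subset.trans hTM,
    matched_diff_pair hTP3 hT (hST haS) (hST hbS) hab, ?_, hS.mono ?_, ?_⟩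
  · have := ncard_diff_pair_add_two (hST haS) (hST hbS) hab.ne
    omega
  · rw [hψ]
    intro u hu
    by_cases h : u ∈ ({a, b} : Set V)
    · exact .inl (.inr (.inr (.inr h)))
    · rcases hu with (hu | hu) | hu
      exacts [.inl (.inl hu), .inl (.inr (.inl hu)), .inr ⟨hu, h⟩]
  · rintro s ⟨hs, hsab⟩
    have hsa : s ≠ a := fun h ↦ hsab (.inl h)
    have hsb : s ≠ b := fun h ↦ hsab (.inr h)
    have hsM := hSM hs
    rw [hψ]
    refine ⟨?_, ?_⟩
    · rintro (h | rfl | h)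
      exacts [(hφS s hs).1 h, hpM hsM, hsab h]
    · rintro r (h | rfl | rfl | rfl) hsr
      · exact (hφS s hs).2 r h hsr
      · exact hpS s hs hsa hsr.symm
      · exact hsb (eq_of_adj_of_not_hasP3 hTP3 (hST hs) (hST haS) (hST hbS) hsr hab)
      · exact hsa (eq_of_adj_of_not_hasP3 hTP3 (hST hs) (hST hbS) (hST haS) hsr hab.symm)

lemma hasP3_of_induce_iso_p4kp3 {A : Set V} {k : ℕ} (e : G.induce A ≃g p4kp3 k) : HasP3 G A := by
  have h : ∀ i j : Fin 4, G.Adj (e.symm (.inl i)) (e.symm (.inl j)) ↔ (pathGraph 4).Adj i j :=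
    fun i j ↦ by
      rw [← comap_adj (f := ((↑) : A → V)), ← SimpleGraph.sum_adj_inl (H := kCopies k (pathGraph 3))]
      exact e.symm.map_adj_iff
  have hne : ((e.symm (.inl 0) : A) : V) ≠ e.symm (.inl 2) := fun h ↦ by
    simpa using e.symm.injective (Subtype.ext h)
  have h1 := (h 0 1).2 (by simp [pathGraph_adj])
  have h2 := (h 1 2).2 (by simp [pathGraph_adj])
  exact ⟨_, _, _, Subtype.prop _, Subtype.prop _, Subtype.prop _, h1.ne, h2.ne, hne, h1, h2⟩

/-- An edge `xy` of `D` such that `x` has a private neighbor `w`, and `w` cannot replace `y`,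
starts a packing. -/
lemma hasPartialPacking_zero [Finite V] {A M : Set V} {x y w : V}
    (hD : IsTotalDomSet G D) (hDP3 : ¬ HasP3 G D) (hMD : M ⊆ D)
    (hM : ∀ s ∈ M, ∃ t ∈ M, G.Adj s t) (hx : x ∈ M) (hy : y ∈ M) (hxy : G.Adj x y)
    (hwM : w ∉ M) (hw : IsPrivateNbr G D x w) (hturn : ¬ IsTotalDomSet G (D \ {y} ∪ {w})) :
    HasPartialPacking G A D M 0 := by
  have hwD : ∀ u ∈ D, G.Adj w u → u = x := fun u hu hwu ↦
    (Set.ext_iff.1 hw u).1 ⟨hu, hwu⟩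
  have hwx : G.Adj w x := ((Set.ext_iff.1 hw x).2 rfl).2
  obtain ⟨v, hv⟩ : ∃ v, ∀ u ∈ D \ {y} ∪ {w}, ¬ G.Adj v u := by
    simpa [IsTotalDomSet] using hturn
  have hvw : ¬ G.Adj v w := hv w (.inr rfl)
  have hvD : ∀ u ∈ D, G.Adj v u → u = y := fun u hu hvu ↦
    by_contra fun huy ↦ hv u (.inl ⟨hu, huy⟩) hvu
  have hvy : G.Adj v y := by
    obtain ⟨u, hu, hvu⟩ := hD v
    exact hvD u hu hvu ▸ hvu
  have hMP3 : ¬ HasP3 G M := fun h ↦ hDP3 (h.mono hMD)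
  have hvM : v ∉ M := fun h ↦
    hvw (eq_of_adj_of_not_hasP3 hMP3 h hy hx hvy hxy.symm ▸ hwx.symm)
  obtain ⟨φ, hφ⟩ := exists_p4kp3_zero_embedding hwx hxy hvy.symm
    (fun h ↦ hxy.ne' (hwD y (hMD hy) h)) (fun h ↦ hxy.ne (hvD x (hMD hx) h.symm))
    (fun h ↦ hvw h.symm)
  refine ⟨φ, M \ {x, y}, M \ {x, y}, subset_rfl, Set.sdiff_subset,
    matched_diff_pair hMP3 hM hx hy hxy, ?_, hD.mono ?_, ?_⟩
  · have := ncard_diff_pair_add_two hx hy hxy.ne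
    omega
  · rw [hφ]
    intro u hu
    by_cases huM : u ∈ M
    · by_cases h : u ∈ ({x, y} : Set V)
      · rcases h with rfl | rfl
        exacts [.inl (.inr (.inr (.inl rfl))), .inl (.inr (.inr (.inr (.inl rfl))))]
      · exact .inr ⟨huM, h⟩
    · exact .inl (.inl (.inr ⟨hu, huM⟩))
  · rintro s ⟨hs, hsxy⟩
    have hsx : s ≠ x := fun h ↦ hsxy (.inl h)
    have hsy : s ≠ y := fun h ↦ hsxy (.inr h)
    rw [hφ]
    refine ⟨?_, ?_⟩
    · rintro (rfl | rfl | rfl | rfl)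
      exacts [hwM hs, hsx rfl, hsy rfl, hvM hs]
    · rintro r (rfl | rfl | rfl | rfl) hsr
      · exact hsx (hwD s (hMD hs) hsr.symm)
      · exact hsy (eq_of_adj_of_not_hasP3 hMP3 hs hx hy hsr hxy)
      · exact hsx (eq_of_adj_of_not_hasP3 hMP3 hs hy hx hsr hxy.symm)
      · exact hsy (hvD s (hMD hs) hsr.symm)

end TD

theorem stmt13 {V : Type*} [Fintype V] (k : ℕ) (hk : 1 ≤ k)
    (G : SimpleGraph V) (hconn : G.Connected) (hfree : IndFree G (p4kp3 k))
    (A B C : Set V) (hA : Nonempty (G.induce A ≃g p4kp3 (k - 1)))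
    (hB : B = {v | v ∉ A ∧ ∃ a ∈ A, G.Adj v a})
    (hC : C = {v | v ∉ A ∧ v ∉ B})
    (hnoP3 : ∀ D' : Set V, IsMinTotalDomSet G D' → ¬ HasP3 G D')
    (D : Set V) (hD : IsMinTotalDomSet G D)
    (hedge : ∃ x y : V, G.Adj x y ∧ x ∈ D ∧ y ∈ D ∧ x ∈ B ∧ y ∈ B ∧
      (∃ w ∈ C, IsPrivateNbr G D x w ∨ IsPrivateNbr G D y w) ∧
      ¬ ∃ z ∈ C, (IsTotalDomSet G ((D \ {x}) ∪ {z}) ∨ IsTotalDomSet G ((D \ {y}) ∪ {z}))) :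
    ({e : Sym2 V | ∃ x y : V, e = s(x, y) ∧ G.Adj x y ∧ x ∈ D ∧ y ∈ D ∧ x ∈ B ∧ y ∈ B}).ncard ≤
      A.ncard + 2 * k := by
  by_contra! hcon
  have hDP3 := hnoP3 D hD
  let M : Set V := {x | x ∈ D ∧ x ∈ B ∧ ∃ y ∈ D, y ∈ B ∧ G.Adj x y}
  have hMD : M ⊆ D := fun x hx ↦ hx.1
  have hM : ∀ s ∈ M, ∃ t ∈ M, G.Adj s t := fun s ⟨hs, hsB, t, ht, htB, hst⟩ ↦
    ⟨t, ⟨ht, htB, s, hs, hsB, hst.symm⟩, hst⟩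
  have hMA : ∀ b ∈ M, b ∉ A ∧ ∃ a ∈ A, G.Adj b a := by
    rintro b ⟨-, hb, -⟩
    rwa [hB] at hb
  have hcard : 2 * (A.ncard + 2 * k) < M.ncard := by
    have h := two_mul_ncard_edges_le (M := M) fun h ↦ hDP3 (h.mono hMD)
    refine lt_of_lt_of_le ?_ h
    refine Nat.mul_lt_mul_of_pos_left (hcon.trans_le (Set.ncard_le_ncard ?_)) two_pos
    rintro e ⟨x, y, he, hxy, hx, hy, hxB, hyB⟩
    exact ⟨x, y, he, hxy, ⟨hx, hxB, y, hy, hyB, hxy⟩, ⟨hy, hyB, x, hx, hxB, hxy.symm⟩⟩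
  have hzero : HasPartialPacking G A D M 0 := by
    obtain ⟨x, y, hxy, hx, hy, hxB, hyB, ⟨w, hwC, hw⟩, hturn⟩ := hedge
    have hxM : x ∈ M := ⟨hx, hxB, y, hy, hyB, hxy⟩
    have hyM : y ∈ M := ⟨hy, hyB, x, hx, hxB, hxy.symm⟩
    have hwM : w ∉ M := fun h ↦ by
      rw [hC] at hwC
      exact hwC.2 h.2.1
    rcases hw with hw | hw
    · exact hasPartialPacking_zero hD.1 hDP3 hMD hM hxM hyM hxy hwM hw
        fun h ↦ hturn ⟨w, hwC, .inr h⟩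
    · exact hasPartialPacking_zero hD.1 hDP3 hMD hM hyM hxM hxy.symm hwM hw
        fun h ↦ hturn ⟨w, hwC, .inl h⟩
  have hpack : ∀ j ≤ k, HasPartialPacking G A D M j := by
    intro j hj
    induction j with
    | zero => exact hzero
    | succ j ih =>
      exact (ih (by omega)).succ hnoP3 hD (hasP3_of_induce_iso_p4kp3 hA.some) hMD hMA (by omega)
  obtain ⟨φ, -⟩ := hpack k le_rfl
  exact hfree ⟨φ⟩
end

section
/- Under the (P4+kP3)-free setup, suppose that no minimum total dominating set of G contains a P3, and let D be a minimum total dominating set of G. Then there are at most |A|−1 cliques K ∈ 𝒦 that contain a C-edge of D and for which there exists a vertex b ∈ N(K) ∩ B with N[K] ⊆ N[b]. -/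
open SimpleGraph

open TD SimpleGraph


namespace TD

theorem p4kp3_inl_adj {n : ℕ} (i j : Fin 4) :
    (p4kp3 n).Adj (Sum.inl i) (Sum.inl j) ↔ (pathGraph 4).Adj i j := Iff.rfl

theorem p4kp3_inr_adj {n : ℕ} (p q : Fin n × Fin 3) :
    (p4kp3 n).Adj (Sum.inr p) (Sum.inr q) ↔ p.1 = q.1 ∧ (pathGraph 3).Adj p.2 q.2 := Iff.rfl

theorem p4kp3_inl_inr_adj {n : ℕ} (i : Fin 4) (q : Fin n × Fin 3) :
    ¬ (p4kp3 n).Adj (Sum.inl i) (Sum.inr q) := by simp [p4kp3]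

theorem p4kp3_inr_inl_adj {n : ℕ} (i : Fin 4) (q : Fin n × Fin 3) :
    ¬ (p4kp3 n).Adj (Sum.inr q) (Sum.inl i) := by simp [p4kp3]

/-- An induced `P4 + nP3` and an anticomplete induced `P3` combine to an induced
`P4 + (n+1)P3`. -/
theorem nonempty_p4kp3_succ_embedding {V : Type*} {G : SimpleGraph V} {n : ℕ}
    (f : p4kp3 n ↪g G) (g : pathGraph 3 ↪g G)
    (hne : ∀ a t, f a ≠ g t) (hadj : ∀ a t, ¬ G.Adj (f a) (g t)) :
    Nonempty (p4kp3 (n + 1) ↪g G) := by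
  have hadj' : ∀ a t, ¬ G.Adj (g t) (f a) := fun a t h => hadj a t h.symm
  have hne' : ∀ a t, g t ≠ f a := fun a t => (hne a t).symm
  let F : Fin 4 ⊕ (Fin (n + 1) × Fin 3) → V := Sum.elim (fun i => f (Sum.inl i))
    (fun p => Fin.lastCases (motive := fun _ => V) (g p.2) (fun j => f (Sum.inr (j, p.2))) p.1)
  have hinl : ∀ i, F (Sum.inl i) = f (Sum.inl i) := fun _ => rfl
  have hlast : ∀ t, F (Sum.inr (Fin.last n, t)) = g t := fun t => by simp [F]
  have hcast : ∀ j t, F (Sum.inr (Fin.castSucc j, t)) = f (Sum.inr (j, t)) :=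
    fun j t => by simp [F]
  have hlc : ∀ j : Fin n, Fin.last n ≠ j.castSucc := fun j => (Fin.castSucc_ne_last j).symm
  have hinj : Function.Injective F := by
    rintro (i | ⟨j, t⟩) (i' | ⟨j', t'⟩) h
    · simpa [hinl] using h
    · induction j' using Fin.lastCases <;> simp_all
    · induction j using Fin.lastCases <;> simp_all
    · induction j using Fin.lastCases <;> induction j' using Fin.lastCases <;> simp_all
  have hF : ∀ x y, G.Adj (F x) (F y) ↔ (p4kp3 (n + 1)).Adj x y := by
    rintro (i | ⟨j, t⟩) (i' | ⟨j', t'⟩)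
    · simp [hinl, p4kp3_inl_adj]
    · induction j' using Fin.lastCases <;>
        simp [hinl, hlast, hcast, hadj, p4kp3_inl_inr_adj]
    · induction j using Fin.lastCases <;>
        simp [hinl, hlast, hcast, hadj', p4kp3_inr_inl_adj]
    · induction j using Fin.lastCases <;> induction j' using Fin.lastCases <;>
        simp [hlast, hcast, hadj, hadj', p4kp3_inr_adj, hlc]
  exact ⟨⟨F, hinj⟩, hF _ _⟩

/-- Two vertices of the anticomplete part with a common neighbor there are adjacent. -/
theorem adj_trans_of_indFree {V : Type*} {G : SimpleGraph V} {n : ℕ}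
    (hfree : IndFree G (p4kp3 (n + 1))) (f : p4kp3 n ↪g G) {C : Set V}
    (hne : ∀ a, f a ∉ C) (hadj : ∀ a, ∀ c ∈ C, ¬ G.Adj (f a) c)
    {u x w : V} (hu : u ∈ C) (hx : x ∈ C) (hw : w ∈ C)
    (hux : G.Adj u x) (hxw : G.Adj x w) (huw : u ≠ w) : G.Adj u w := by
  by_contra hn
  have hn' : ¬ G.Adj w u := fun h => hn h.symm
  have hC : ∀ t, ![u, x, w] t ∈ C := by
    intro t
    fin_cases t <;> assumption
  have hinj : Function.Injective ![u, x, w] := by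
    intro s t
    fin_cases s <;> fin_cases t <;>
      simp [hux.ne, hux.ne', hxw.ne, hxw.ne', huw, huw.symm]
  have hg : ∀ s t, G.Adj (![u, x, w] s) (![u, x, w] t) ↔ (pathGraph 3).Adj s t := by
    intro s t
    fin_cases s <;> fin_cases t <;>
      simp [pathGraph_adj, hux, hux.symm, hxw, hxw.symm, hn, hn']
  let g : pathGraph 3 ↪g G := ⟨⟨![u, x, w], hinj⟩, hg _ _⟩
  exact hfree (nonempty_p4kp3_succ_embedding f g
    (fun a t h => hne a (h ▸ hC t)) (fun a t => hadj a _ (hC t)))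

theorem IsMaxCliqueWithin.eq_of_mem {V : Type*} {G : SimpleGraph V} {C K L : Set V}
    (htrans : ∀ u ∈ C, ∀ x ∈ C, ∀ w ∈ C, G.Adj u x → G.Adj x w → u ≠ w → G.Adj u w)
    (hK : IsMaxCliqueWithin G C K) (hL : IsMaxCliqueWithin G C L) {x : V}
    (hxK : x ∈ K) (hxL : x ∈ L) : K = L := by
  have key : ∀ u ∈ K, ∀ w ∈ L, u ≠ w → G.Adj u w := by
    intro u hu w hw huw
    by_cases h1 : u = x
    · exact hL.2.1 (h1 ▸ hxL) hw huw
    by_cases h2 : x = w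
    · exact hK.2.1 hu (h2 ▸ hxK) huw
    exact htrans u (hK.1 hu) x (hK.1 hxK) w (hL.1 hw) (hK.2.1 hu hxK h1) (hL.2.1 hxL hw h2) huw
  have hsub : K ∪ L ⊆ C := Set.union_subset hK.1 hL.1
  have hcl : G.IsClique (K ∪ L) := by
    rintro u (hu | hu) w (hw | hw) huw
    · exact hK.2.1 hu hw huw
    · exact key u hu w hw huw
    · exact (key w hw u hu huw.symm).symm
    · exact hL.2.1 hu hw huw
  exact (hK.2.2 _ hsub hcl Set.subset_union_left).symm.trans
    (hL.2.2 _ hsub hcl Set.subset_union_right)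

theorem totalDomNum_le {V : Type*} {G : SimpleGraph V} {D : Set V} (h : IsTotalDomSet G D) :
    totalDomNum G ≤ D.ncard :=
  Nat.sInf_le ⟨D, h, rfl⟩

theorem HasP3.mono_s17 {V : Type*} {G : SimpleGraph V} {S T : Set V} (hST : S ⊆ T)
    (h : HasP3 G S) : HasP3 G T := by
  obtain ⟨a, b, c, ha, hb, hc, h⟩ := h
  exact ⟨a, b, c, hST ha, hST hb, hST hc, h⟩

theorem hasP3_of_p4kp3_embedding {V : Type*} {G : SimpleGraph V} {n : ℕ} (f : p4kp3 n ↪g G)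
    {A : Set V} (hA : ∀ a, f a ∈ A) : HasP3 G A := by
  refine ⟨f (Sum.inl 0), f (Sum.inl 1), f (Sum.inl 2), hA _, hA _, hA _, ?_, ?_, ?_, ?_, ?_⟩
  · simp
  · simp
  · simp
  · rw [f.map_adj_iff, p4kp3_inl_adj, pathGraph_adj]
    simp
  · rw [f.map_adj_iff, p4kp3_inl_adj, pathGraph_adj]
    simp

/-- Replacing both ends of an edge inside `K` by a vertex `b K` for each `K ∈ S`, and adding `A`,
keeps a set total dominating. -/
theorem IsTotalDomSet.exchange {V : Type*} {G : SimpleGraph V} {D A : Set V}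
    (hD : IsTotalDomSet G D) {S : Set (Set V)} {R : Set V} {b : Set V → V}
    (hR : ∀ u ∈ R, ∃ K ∈ S, u ∈ K)
    (hb : ∀ K ∈ S, ∃ a ∈ A, G.Adj (b K) a)
    (hKb : ∀ K ∈ S, closedNbhd G K ⊆ closedNbhd G {b K}) :
    IsTotalDomSet G (D \ R ∪ (b '' S ∪ A)) := by
  intro v
  obtain ⟨u, huD, hvu⟩ := hD v
  by_cases huR : u ∈ R
  · obtain ⟨K, hKS, huK⟩ := hR u huR
    rcases hKb K hKS (Or.inr ⟨u, huK, hvu.symm⟩) with hv | ⟨w, hw, hwv⟩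
    · obtain ⟨a, ha, hba⟩ := hb K hKS
      rw [Set.mem_singleton_iff] at hv
      exact ⟨a, Or.inr (Or.inr ha), hv ▸ hba⟩
    · rw [Set.mem_singleton_iff] at hw
      exact ⟨b K, Or.inr (Or.inl ⟨K, hKS, rfl⟩), hw ▸ hwv.symm⟩
  · exact ⟨u, Or.inl ⟨huD, huR⟩, hvu⟩

end TD

theorem stmt17 {V : Type*} [Fintype V] (k : ℕ) (hk : 1 ≤ k)
    (G : SimpleGraph V) (hconn : G.Connected) (hfree : IndFree G (p4kp3 k))
    (A B C : Set V) (hA : Nonempty (G.induce A ≃g p4kp3 (k - 1)))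
    (hB : B = {v | v ∉ A ∧ ∃ a ∈ A, G.Adj v a})
    (hC : C = {v | v ∉ A ∧ v ∉ B})
    (hnoP3 : ∀ D' : Set V, IsMinTotalDomSet G D' → ¬ HasP3 G D')
    (D : Set V) (hD : IsMinTotalDomSet G D) :
    ({K : Set V | IsMaxCliqueWithin G C K ∧
        (∃ x ∈ K, ∃ y ∈ K, x ∈ D ∧ y ∈ D ∧ G.Adj x y) ∧
        ∃ b ∈ nbhd G K ∩ B, closedNbhd G K ⊆ closedNbhd G {b}}).ncard ≤
      A.ncard - 1 := by
  obtain ⟨n, rfl⟩ : ∃ n, k = n + 1 := ⟨k - 1, by omega⟩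
  rw [Nat.add_sub_cancel] at hA
  obtain ⟨e⟩ := hA
  let f : p4kp3 n ↪g G := e.symm.toEmbedding.trans (Embedding.induce A)
  have hfA : ∀ a, f a ∈ A := fun a => (e.symm a).2
  have htrans : ∀ u ∈ C, ∀ x ∈ C, ∀ w ∈ C, G.Adj u x → G.Adj x w → u ≠ w → G.Adj u w := by
    intro u hu x hx w hw
    refine adj_trans_of_indFree hfree f ?_ ?_ hu hx hw
    · intro a ha
      rw [hC] at ha
      exact ha.1 (hfA a)
    · intro a c hc h
      rw [hC, hB] at hc
      exact hc.2 ⟨hc.1, f a, hfA a, h.symm⟩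
  set S := {K : Set V | IsMaxCliqueWithin G C K ∧
        (∃ x ∈ K, ∃ y ∈ K, x ∈ D ∧ y ∈ D ∧ G.Adj x y) ∧
        ∃ b ∈ nbhd G K ∩ B, closedNbhd G K ⊆ closedNbhd G {b}}
  by_contra hlt
  have hcard : A.ncard ≤ S.ncard := by omega
  have hedge : ∀ K, ∃ p : V × V, K ∈ S → p.1 ∈ K ∧ p.2 ∈ K ∧ p.1 ∈ D ∧ p.2 ∈ D ∧ p.1 ≠ p.2 := by
    intro K
    by_cases hK : K ∈ S
    · obtain ⟨x, hx, y, hy, hxD, hyD, hxy⟩ := hK.2.1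
      exact ⟨(x, y), fun _ => ⟨hx, hy, hxD, hyD, hxy.ne⟩⟩
    · exact ⟨(f (Sum.inl 0), f (Sum.inl 0)), fun h => absurd h hK⟩
  have hdom : ∀ K, ∃ b : V, K ∈ S → b ∈ B ∧ closedNbhd G K ⊆ closedNbhd G {b} := by
    intro K
    by_cases hK : K ∈ S
    · obtain ⟨b, hb, hKb⟩ := hK.2.2
      exact ⟨b, fun _ => ⟨hb.2, hKb⟩⟩
    · exact ⟨f (Sum.inl 0), fun h => absurd h hK⟩
  choose p hp using hedge
  choose b hb using hdom
  have heq : ∀ K ∈ S, ∀ L ∈ S, ∀ x, x ∈ K → x ∈ L → K = L := fun K hK L hL x hxK hxL =>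
    hK.1.eq_of_mem htrans hL.1 hxK hxL
  set X := (fun K => (p K).1) '' S
  set Y := (fun K => (p K).2) '' S
  have hXcard : X.ncard = S.ncard := Set.InjOn.ncard_image fun K hK L hL (h : (p K).1 = _) =>
    heq K hK L hL (p K).1 (hp K hK).1 (h ▸ (hp L hL).1)
  have hYcard : Y.ncard = S.ncard := Set.InjOn.ncard_image fun K hK L hL (h : (p K).2 = _) =>
    heq K hK L hL (p K).2 (hp K hK).2.1 (h ▸ (hp L hL).2.1)
  have hXY : Disjoint X Y := by
    rw [Set.disjoint_left]
    rintro _ ⟨K, hK, rfl⟩ ⟨L, hL, h⟩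
    have h' : (p L).2 = (p K).1 := h
    have hKL := heq K hK L hL (p K).1 (hp K hK).1 (h' ▸ (hp L hL).2.1)
    subst hKL
    exact (hp K hK).2.2.2.2 h'.symm
  have hRD : X ∪ Y ⊆ D := by
    rintro _ (⟨K, hK, rfl⟩ | ⟨K, hK, rfl⟩)
    · exact (hp K hK).2.2.1
    · exact (hp K hK).2.2.2.1
  have hRcard : (X ∪ Y).ncard = S.ncard + S.ncard := by
    rw [Set.ncard_union_eq hXY, hXcard, hYcard]
  have hdom' : IsTotalDomSet G (D \ (X ∪ Y) ∪ (b '' S ∪ A)) := by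
    refine hD.1.exchange ?_ ?_ (fun K hK => (hb K hK).2)
    · rintro _ (⟨K, hK, rfl⟩ | ⟨K, hK, rfl⟩)
      · exact ⟨K, hK, (hp K hK).1⟩
      · exact ⟨K, hK, (hp K hK).2.1⟩
    · intro K hK
      have hbB := (hb K hK).1
      rw [hB] at hbB
      exact hbB.2
  have hle : (D \ (X ∪ Y) ∪ (b '' S ∪ A)).ncard ≤ D.ncard := by
    have h1 := Set.ncard_union_le (D \ (X ∪ Y)) (b '' S ∪ A)
    have h2 := Set.ncard_union_le (b '' S) A
    have h3 : (b '' S).ncard ≤ S.ncard := Set.ncard_image_le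
    have h4 := Set.ncard_sdiff_add_ncard_of_subset hRD
    omega
  refine hnoP3 _ ⟨hdom', le_antisymm (hle.trans hD.2.le) (totalDomNum_le hdom')⟩ ?_
  exact (hasP3_of_p4kp3_embedding f hfA).mono_s17 fun a ha => Or.inr (Or.inr ha)
end
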